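/- arXiv:2507.10784 — 2 statements merged into one kernel-verified Lean document; each statement's English description precedes it below -/
import Mathlib

section
/- Let d ≥ 2, D ≥ d, n ≥ 1 and N ≥ 2 be integers such that 3(d−1)N/2 ≤ n/d + d − 2 and n/d − 3(d−1)N/2 + D − d > 0. Then there exists a vector v : Y(d,n) → ℝ with v_α ≥ 0 for all α and Σ_α v_α² = 1 such that Σ_{α,β ∈ Y(d,n)} v_α (M_est(n,d,D))_{αβ} v_β ≥ 1 − π²(d−1)²/(d²N²) − (D−d)/(n/d − 3(d−1)N/2 + D − d). (This is the achievability bound of Lemma 2, giving a protocol of isometry estimation with fidelity at least the right-hand side.) -/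
open scoped Classical

noncomputable section

/-- The set `Y(d,n)` of Young diagrams: tuples `α ∈ ℤ^d` with
`α 1 ≥ ⋯ ≥ α d ≥ 0` and `∑ i, α i = n`. -/
def Ydn (d n : ℕ) : Finset (Fin d → ℤ) :=
  (Fintype.piFinset fun _ => Finset.Icc (0 : ℤ) (n : ℤ)).filter
    (fun α => (∀ i j : Fin d, i ≤ j → α j ≤ α i) ∧ (∀ i, 0 ≤ α i) ∧ (∑ i, α i) = (n : ℤ))

/-- `f(x) = √((x + d + 1)/(x + D + 1))`. -/
def fEst (d D : ℕ) (x : ℝ) : ℝ := Real.sqrt ((x + d + 1) / (x + D + 1))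

/-- The `i`-th standard basis vector of `ℤ^d`. -/
def ebasis (d : ℕ) (i : Fin d) : Fin d → ℤ := fun j => if j = i then 1 else 0

/-- The estimation matrix `M_est(n,d,D)`, with 1-based indices `α_i - i` expressed
through 0-based `Fin d` indices as `α i - (i + 1)`. -/
def Mest (n d D : ℕ) (α β : Fin d → ℤ) : ℝ :=
  (1 / (d : ℝ) ^ 2) * ∑ i : Fin d, ∑ j : Fin d,
    (if α + ebasis d i = β + ebasis d j then (1 : ℝ) else 0)
      * fEst d D ((α i : ℝ) - ((i : ℕ) + 1))
      * fEst d D ((β j : ℝ) - ((j : ℕ) + 1))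

/-- A unit vector supported on `[0, N)` with nearest-neighbour correlation `cos (π / N)`. -/
lemma exists_sine_profile (N : ℕ) (hN : 2 ≤ N) :
    ∃ g : ℤ → ℝ, (∀ z, 0 ≤ g z) ∧ (∀ z, g z ≠ 0 → 0 ≤ z ∧ z < N) ∧
      ∑ k ∈ Finset.range N, g k * g k = 1 ∧
      ∑ k ∈ Finset.range N, g k * g (k + 1) = Real.cos (Real.pi / N) ∧
      ∑ k ∈ Finset.range N, g k * g (k - 1) = Real.cos (Real.pi / N) := by
  have hN0 : (0 : ℝ) < N := by positivity
  set w : ℤ → ℝ := fun z => if 0 ≤ z ∧ z < N then Real.sin (z * (Real.pi / N)) else 0 with hw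
  have w_nonneg : ∀ z, 0 ≤ w z := by
    intro z
    simp only [hw]
    split_ifs with h
    · have h0 : (0 : ℝ) ≤ z := by exact_mod_cast h.1
      have h1 : (z : ℝ) ≤ N := by exact_mod_cast h.2.le
      refine Real.sin_nonneg_of_nonneg_of_le_pi (by positivity) ?_
      calc (z : ℝ) * (Real.pi / N) ≤ N * (Real.pi / N) := by gcongr
        _ = Real.pi := by field_simp
    · exact le_rfl
  have w_zero : w 0 = 0 := by simp [hw]
  have w_eq : ∀ z : ℤ, 0 ≤ z → z ≤ N → w z = Real.sin (z * (Real.pi / N)) := by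
    intro z h0 h1
    simp only [hw]
    split_ifs with h
    · rfl
    · have : z = N := by omega
      subst this
      have : ((N : ℤ) : ℝ) * (Real.pi / N) = Real.pi := by push_cast; field_simp
      rw [this, Real.sin_pi]
  have w_rec : ∀ k ∈ Finset.range N,
      w k * w (k + 1) + w k * w (k - 1) = 2 * Real.cos (Real.pi / N) * (w k * w k) := by
    intro k hk
    have hk := Finset.mem_range.mp hk
    rcases Nat.eq_zero_or_pos k with rfl | hk0
    · simp [w_zero]
    · rw [w_eq k (by omega) (by omega), w_eq (k + 1) (by omega) (by omega),
        w_eq (k - 1) (by omega) (by omega)]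
      push_cast
      rw [add_mul, sub_mul, one_mul, Real.sin_add, Real.sin_sub]
      ring
  have w_symm : ∑ k ∈ Finset.range N, w k * w (k + 1)
      = ∑ k ∈ Finset.range N, w k * w (k - 1) := by
    have h := Finset.sum_range_sub (fun k : ℕ => w k * w (k - 1)) N
    have hwN : w N = 0 := by simp [hw]
    simp only [Nat.cast_zero, w_zero, hwN, zero_mul, sub_zero, Finset.sum_sub_distrib] at h
    rw [← sub_eq_zero, ← h]
    congr 1
    refine Finset.sum_congr rfl fun k _ => ?_
    push_cast
    rw [add_sub_cancel_right, mul_comm]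
  set S := ∑ k ∈ Finset.range N, w k * w k with hS
  have S_pos : 0 < S := by
    refine Finset.sum_pos' (fun k _ => mul_self_nonneg _) ⟨1, by simp; omega, ?_⟩
    have h1 : w ((1 : ℕ) : ℤ) = Real.sin (Real.pi / N) := by
      rw [w_eq _ (by simp) (by push_cast; omega)]; simp
    have h2 : 0 < Real.sin (Real.pi / N) := by
      refine Real.sin_pos_of_pos_of_lt_pi (by positivity) (div_lt_self Real.pi_pos ?_)
      exact_mod_cast hN
    rw [h1]
    positivity
  have w_sum : ∑ k ∈ Finset.range N, w k * w (k + 1) = Real.cos (Real.pi / N) * S := by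
    have h := Finset.sum_congr rfl w_rec
    rw [Finset.sum_add_distrib, ← w_symm, ← Finset.mul_sum, ← hS] at h
    linarith
  have scale : ∀ u : ℕ → ℤ, ∑ k ∈ Finset.range N, w k / √S * (w (u k) / √S)
      = (∑ k ∈ Finset.range N, w k * w (u k)) / S := by
    intro u
    rw [Finset.sum_div]
    refine Finset.sum_congr rfl fun k _ => ?_
    rw [div_mul_div_comm, Real.mul_self_sqrt S_pos.le]
  refine ⟨fun z => w z / √S, fun z => div_nonneg (w_nonneg z) (Real.sqrt_nonneg _), ?_, ?_, ?_, ?_⟩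
  · intro z hz
    by_contra h
    exact hz (by simp [hw, h])
  · rw [scale (fun k => (k : ℤ)), ← hS, div_self S_pos.ne']
  · rw [scale (fun k => (k : ℤ) + 1), w_sum, mul_div_cancel_right₀ _ S_pos.ne']
  · rw [scale (fun k => (k : ℤ) - 1), ← w_symm, w_sum, mul_div_cancel_right₀ _ S_pos.ne']

lemma ebasis_castSucc_castSucc {m : ℕ} (i l : Fin m) :
    ebasis (m + 1) i.castSucc l.castSucc = if l = i then 1 else 0 := by
  simp [ebasis]

lemma ebasis_last_castSucc {m : ℕ} (l : Fin m) :
    ebasis (m + 1) (Fin.last m) l.castSucc = 0 := by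
  simp [ebasis, (Fin.castSucc_lt_last l).ne]

lemma sum_ebasis (d : ℕ) (i : Fin d) : ∑ l, ebasis d i l = 1 := by
  simp [ebasis]

/-- If a shift by `±1` in one coordinate costs a factor `c`, the average over all pairs of
directions is controlled by `1 - c`. -/
lemma sum_prod_shift_ge (m : ℕ) (hm : 1 ≤ m) (h : ℤ → ℝ) (c : ℝ)
    (h0 : h 0 = 1) (h1 : h 1 = c) (h2 : h (-1) = c) :
    ((m : ℝ) + 1) ^ 2 - 2 * (m : ℝ) ^ 2 * (1 - c) ≤
      ∑ i : Fin (m + 1), ∑ j : Fin (m + 1), ∏ l : Fin m,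
        h (ebasis (m + 1) i l.castSucc - ebasis (m + 1) j l.castSucc) := by
  have hcc : ∀ i j : Fin m, ∏ l : Fin m, h (ebasis (m + 1) i.castSucc l.castSucc
      - ebasis (m + 1) j.castSucc l.castSucc) = c ^ 2 + if i = j then 1 - c ^ 2 else 0 := by
    intro i j
    simp only [ebasis_castSucc_castSucc]
    by_cases hij : i = j
    · simp [hij, h0]
    · have : ∀ l : Fin m, h ((if l = i then 1 else 0) - (if l = j then 1 else 0))
          = (if l = i then c else 1) * (if l = j then c else 1) := by
        intro l
        by_cases hi : l = i
        · have : l ≠ j := fun hj => hij (hi.symm.trans hj)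
          simp [hi, hij, h1]
        · by_cases hj : l = j <;> simp [hi, hj, h0, h2, Ne.symm hij]
      simp only [this, Finset.prod_mul_distrib]
      simp [hij, sq]
  have hcl : ∀ i : Fin m, ∏ l : Fin m, h (ebasis (m + 1) i.castSucc l.castSucc
      - ebasis (m + 1) (Fin.last m) l.castSucc) = c := by
    intro i
    have : ∀ l : Fin m, h ((if l = i then 1 else 0) - 0) = if l = i then c else 1 := by
      intro l; split_ifs <;> simp [h0, h1]
    simp only [ebasis_castSucc_castSucc, ebasis_last_castSucc, this]
    simp
  have hlc : ∀ i : Fin m, ∏ l : Fin m, h (ebasis (m + 1) (Fin.last m) l.castSucc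
      - ebasis (m + 1) i.castSucc l.castSucc) = c := by
    intro i
    have : ∀ l : Fin m, h (0 - (if l = i then 1 else 0)) = if l = i then c else 1 := by
      intro l; split_ifs <;> simp [h0, h2]
    simp only [ebasis_castSucc_castSucc, ebasis_last_castSucc, this]
    simp
  simp only [Fin.sum_univ_castSucc, hcc, hcl, hlc]
  simp only [sub_self, h0, Finset.prod_const_one, Finset.sum_add_distrib, Finset.sum_const,
    Finset.card_univ, Fintype.card_fin, nsmul_eq_mul, Finset.sum_ite_eq, Finset.mem_univ, if_true]
  have hm' : (1 : ℝ) ≤ m := by exact_mod_cast hm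
  nlinarith [mul_nonneg (mul_nonneg (by linarith : (0 : ℝ) ≤ m) (sub_nonneg.mpr hm'))
    (sq_nonneg (1 - c))]

/-- The tuple with first `m` entries `a + k` whose last entry makes the total equal to `n`. -/
def completeTuple (m n : ℕ) (a : Fin m → ℤ) (k : Fin m → ℕ) : Fin (m + 1) → ℤ :=
  Fin.snoc (α := fun _ => ℤ) (fun i => a i + k i) (n - ∑ i, (a i + k i))

@[simp]
lemma completeTuple_castSucc (m n : ℕ) (a : Fin m → ℤ) (k : Fin m → ℕ) (i : Fin m) :
    completeTuple m n a k i.castSucc = a i + k i := by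
  simp [completeTuple]

@[simp]
lemma completeTuple_last (m n : ℕ) (a : Fin m → ℤ) (k : Fin m → ℕ) :
    completeTuple m n a k (Fin.last m) = n - ∑ i, (a i + k i) := by
  simp [completeTuple]

lemma sum_completeTuple (m n : ℕ) (a : Fin m → ℤ) (k : Fin m → ℕ) :
    ∑ i, completeTuple m n a k i = n := by
  simp [Fin.sum_univ_castSucc]

lemma completeTuple_injective (m n : ℕ) (a : Fin m → ℤ) :
    Function.Injective (completeTuple m n a) := by
  intro k k' h
  funext i
  simpa using congrFun h i.castSucc

lemma mem_Ydn_of_antitone {d n : ℕ} {α : Fin d → ℤ} (hα : Antitone α) (h0 : ∀ i, 0 ≤ α i)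
    (hs : ∑ i, α i = n) : α ∈ Ydn d n := by
  simp only [Ydn, Finset.mem_filter, Fintype.mem_piFinset, Finset.mem_Icc]
  refine ⟨fun i => ⟨h0 i, ?_⟩, fun i j hij => hα hij, h0, hs⟩
  rw [← hs]
  exact Finset.single_le_sum (fun j _ => h0 j) (Finset.mem_univ i)

/-- The product state `∏ g (α_i - a_i)` on tuples of total `n`. -/
def productState (m n : ℕ) (a : Fin m → ℤ) (g : ℤ → ℝ) (α : Fin (m + 1) → ℤ) : ℝ :=
  if ∑ i, α i = n then ∏ l : Fin m, g (α l.castSucc - a l) else 0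

section ProductState

variable {m n N : ℕ} {a : Fin m → ℤ} {g : ℤ → ℝ}

lemma productState_nonneg (hg : ∀ z, 0 ≤ g z) (α : Fin (m + 1) → ℤ) :
    0 ≤ productState m n a g α := by
  unfold productState
  split_ifs
  · exact Finset.prod_nonneg fun l _ => hg _
  · exact le_rfl

lemma exists_completeTuple_of_productState_ne_zero (hg : ∀ z, g z ≠ 0 → 0 ≤ z ∧ z < N)
    {α : Fin (m + 1) → ℤ} (hα : productState m n a g α ≠ 0) :
    ∃ k ∈ Fintype.piFinset (fun _ : Fin m => Finset.range N), completeTuple m n a k = α := by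
  unfold productState at hα
  split_ifs at hα with hs
  · have hz : ∀ l : Fin m, 0 ≤ α l.castSucc - a l ∧ α l.castSucc - a l < N := fun l =>
      hg _ (Finset.prod_ne_zero_iff.mp hα l (Finset.mem_univ l))
    have hk : ∀ l : Fin m, a l + ((α l.castSucc - a l).toNat : ℤ) = α l.castSucc := by
      intro l; have := hz l; omega
    refine ⟨fun l => (α l.castSucc - a l).toNat, ?_, ?_⟩
    · simp only [Fintype.mem_piFinset, Finset.mem_range]
      intro l; have := hz l; omega
    · funext i
      refine Fin.lastCases ?_ (fun l => ?_) i
      · rw [completeTuple_last]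
        simp only [hk]
        rw [Fin.sum_univ_castSucc] at hs
        linarith
      · rw [completeTuple_castSucc, hk]
  · exact absurd rfl hα

lemma productState_completeTuple_add (k : Fin m → ℕ) (i j : Fin (m + 1)) :
    productState m n a g (completeTuple m n a k + ebasis (m + 1) i - ebasis (m + 1) j)
      = ∏ l : Fin m, g (k l + (ebasis (m + 1) i l.castSucc - ebasis (m + 1) j l.castSucc)) := by
  unfold productState
  rw [if_pos]
  · refine Finset.prod_congr rfl fun l _ => ?_
    simp only [Pi.add_apply, Pi.sub_apply, completeTuple_castSucc]
    congr 1
    ring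
  · simp [Finset.sum_add_distrib, Finset.sum_sub_distrib, sum_completeTuple, sum_ebasis]

lemma sum_productState_mul_shift (hg : ∀ z, g z ≠ 0 → 0 ≤ z ∧ z < N)
    (hY : ∀ k ∈ Fintype.piFinset (fun _ : Fin m => Finset.range N),
      completeTuple m n a k ∈ Ydn (m + 1) n) (i j : Fin (m + 1)) :
    ∑ α ∈ Ydn (m + 1) n, productState m n a g α
        * productState m n a g (α + ebasis (m + 1) i - ebasis (m + 1) j)
      = ∏ l : Fin m, ∑ k ∈ Finset.range N,
          g k * g (k + (ebasis (m + 1) i l.castSucc - ebasis (m + 1) j l.castSucc)) := by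
  rw [Finset.prod_univ_sum]
  symm
  refine Finset.sum_of_injOn (completeTuple m n a) (completeTuple_injective m n a).injOn
    (fun k hk => hY k hk) ?_ ?_
  · intro α _ hα
    by_contra h
    obtain ⟨k, hk, rfl⟩ := exists_completeTuple_of_productState_ne_zero hg (left_ne_zero_of_mul h)
    exact hα ⟨k, hk, rfl⟩
  · intro k _
    have h := productState_completeTuple_add (n := n) (a := a) (g := g) k i i
    rw [add_sub_cancel_right] at h
    rw [productState_completeTuple_add, h]
    simp [Finset.prod_mul_distrib]

end ProductState

lemma sqrt_le_fEst {d D : ℕ} (hdD : d ≤ D) {x y : ℝ} (hxD : 0 < x + (D - d))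
    (hxy : x ≤ y + d + 1) : √(x / (x + (D - d))) ≤ fEst d D y := by
  have hD : (d : ℝ) ≤ D := by exact_mod_cast hdD
  refine Real.sqrt_le_sqrt ?_
  rw [div_le_div_iff₀ hxD (by linarith)]
  nlinarith [mul_nonneg (sub_nonneg.mpr hxy) (sub_nonneg.mpr hD)]

lemma Mest_nonneg (n d D : ℕ) (α β : Fin d → ℤ) : 0 ≤ Mest n d D α β := by
  unfold Mest fEst
  refine mul_nonneg (by positivity) (Finset.sum_nonneg fun i _ => Finset.sum_nonneg fun j _ => ?_)
  split_ifs <;> positivity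

/-- A vector supported on tuples with entries at least `x` has quadratic form at least
`x / (x + D - d)` times its averaged translation correlations. -/
lemma quadraticForm_Mest_ge {n d D : ℕ} (hdD : d ≤ D) {v : (Fin d → ℤ) → ℝ} {x : ℝ}
    (hx : 0 ≤ x) (hxD : 0 < x + (D - d)) (hv : ∀ α, 0 ≤ v α)
    (hY : ∀ α, v α ≠ 0 → α ∈ Ydn d n) (hvx : ∀ α, v α ≠ 0 → ∀ i, x ≤ α i) :
    x / (x + (D - d)) * (1 / (d : ℝ) ^ 2 * ∑ i : Fin d, ∑ j : Fin d, ∑ α ∈ Ydn d n,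
        v α * v (α + ebasis d i - ebasis d j))
      ≤ ∑ α ∈ Ydn d n, ∑ β ∈ Ydn d n, v α * Mest n d D α β * v β := by
  set r := x / (x + (D - d)) with hr
  have hr0 : 0 ≤ r := by positivity
  have hf : ∀ α, v α ≠ 0 → ∀ i : Fin d, √r ≤ fEst d D ((α i : ℝ) - ((i : ℕ) + 1)) := by
    intro α hα i
    refine sqrt_le_fEst hdD hxD ?_
    have h1 := hvx α hα i
    have h2 : ((i : ℕ) : ℝ) ≤ d := by exact_mod_cast i.2.le
    linarith
  have hterm : ∀ α β i j, r * ((if α + ebasis d i = β + ebasis d j then (1 : ℝ) else 0)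
      * (v α * v β)) ≤ (if α + ebasis d i = β + ebasis d j then (1 : ℝ) else 0)
      * fEst d D ((α i : ℝ) - ((i : ℕ) + 1))
      * fEst d D ((β j : ℝ) - ((j : ℕ) + 1)) * (v α * v β) := by
    intro α β i j
    by_cases hα : v α = 0
    · simp [hα]
    by_cases hβ : v β = 0
    · simp [hβ]
    split_ifs
    · have h := mul_le_mul (hf α hα i) (hf β hβ j) (Real.sqrt_nonneg _) (Real.sqrt_nonneg _)
      rw [Real.mul_self_sqrt hr0] at h
      simpa using mul_le_mul_of_nonneg_right h (mul_nonneg (hv α) (hv β))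
    · simp
  have hshift : ∀ i j α, v α * v (α + ebasis d i - ebasis d j) = ∑ β ∈ Ydn d n,
      (if α + ebasis d i = β + ebasis d j then (1 : ℝ) else 0) * (v α * v β) := by
    intro i j α
    have : ∀ β, (α + ebasis d i = β + ebasis d j) ↔ α + ebasis d i - ebasis d j = β :=
      fun β => sub_eq_iff_eq_add.symm
    simp only [this, ite_mul, one_mul, zero_mul, Finset.sum_ite_eq]
    split_ifs with h
    · rfl
    · rw [not_not.mp (mt (hY _) h), mul_zero]
  have hform : ∑ α ∈ Ydn d n, ∑ β ∈ Ydn d n, v α * Mest n d D α β * v β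
      = 1 / (d : ℝ) ^ 2 * ∑ i : Fin d, ∑ j : Fin d, ∑ α ∈ Ydn d n, ∑ β ∈ Ydn d n,
        (if α + ebasis d i = β + ebasis d j then (1 : ℝ) else 0)
        * fEst d D ((α i : ℝ) - ((i : ℕ) + 1))
        * fEst d D ((β j : ℝ) - ((j : ℕ) + 1)) * (v α * v β) := by
    have hM : ∀ α β, v α * Mest n d D α β * v β = 1 / (d : ℝ) ^ 2 * ∑ i : Fin d, ∑ j : Fin d,
        (if α + ebasis d i = β + ebasis d j then (1 : ℝ) else 0)
        * fEst d D ((α i : ℝ) - ((i : ℕ) + 1))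
        * fEst d D ((β j : ℝ) - ((j : ℕ) + 1)) * (v α * v β) := by
      intro α β
      simp only [← Finset.sum_mul]
      unfold Mest
      ring
    simp only [hM, ← Finset.mul_sum]
    congr 1
    have hcomm : ∀ F : (Fin d → ℤ) → (Fin d → ℤ) → Fin d → Fin d → ℝ,
        ∑ α ∈ Ydn d n, ∑ β ∈ Ydn d n, ∑ i, ∑ j, F α β i j
          = ∑ i, ∑ j, ∑ α ∈ Ydn d n, ∑ β ∈ Ydn d n, F α β i j := by
      intro F
      simp only [← Finset.sum_product' (Ydn d n) (Ydn d n),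
        ← Finset.sum_product' (Finset.univ : Finset (Fin d)) (Finset.univ : Finset (Fin d))]
      exact Finset.sum_comm
    exact hcomm _
  rw [hform, mul_left_comm]
  refine mul_le_mul_of_nonneg_left ?_ (by positivity)
  simp only [hshift, Finset.mul_sum]
  exact Finset.sum_le_sum fun i _ => Finset.sum_le_sum fun j _ => Finset.sum_le_sum fun α _ =>
    Finset.sum_le_sum fun β _ => hterm α β i j

lemma sum_fin_rev_cast (m : ℕ) : ∑ i : Fin m, ((m : ℝ) - 1 - (i : ℕ)) = m * (m - 1) / 2 := by
  have h : ∀ k : ℕ, ∑ i ∈ Finset.range k, (i : ℝ) = k * (k - 1) / 2 := by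
    intro k
    induction k with
    | zero => simp
    | succ k ih => rw [Finset.sum_range_succ, ih]; push_cast; ring
  rw [Finset.sum_sub_distrib, Fin.sum_univ_eq_sum_range (fun i => (i : ℝ)), h]
  simp
  ring

/-- Disjoint decreasing windows of width `N` in the first `m` coordinates, placed so that the
completed tuples are Young diagrams with all rows at least `n / (m + 1) - 3 m N / 2`. -/
lemma exists_windows (m n N : ℕ) (hN : 1 ≤ N)
    (hx : 0 ≤ (n : ℝ) / (m + 1) - 3 * m * N / 2) :
    ∃ a : Fin m → ℤ, ∀ k ∈ Fintype.piFinset (fun _ : Fin m => Finset.range N),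
      completeTuple m n a k ∈ Ydn (m + 1) n ∧
      ∀ i, (n : ℝ) / (m + 1) - 3 * m * N / 2 ≤ completeTuple m n a k i := by
  set q : ℝ := n / (m + 1) - N * (m * (m - 1)) / (2 * (m + 1)) with hq
  have hqn : (m + 1) * q = n - N * (m * (m - 1) / 2) := by rw [hq]; field_simp
  set A : ℤ := ⌈q⌉
  have hA1 : q ≤ A := Int.le_ceil q
  have hA2 : (A : ℝ) < q + 1 := Int.ceil_lt_add_one q
  refine ⟨fun i => A + (m - 1 - (i : ℕ)) * N, fun k hk => ?_⟩
  simp only [Fintype.mem_piFinset, Finset.mem_range] at hk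
  set a : Fin m → ℤ := fun i => A + (m - 1 - (i : ℕ)) * N with ha
  set α := completeTuple m n a k with hα
  have hsum : ((∑ i, (a i + (k i : ℤ)) : ℤ) : ℝ)
      = m * A + N * (m * (m - 1) / 2) + ∑ i, (k i : ℝ) := by
    rw [← sum_fin_rev_cast, Finset.mul_sum]
    push_cast [ha]
    simp only [Finset.sum_add_distrib]
    simp [mul_comm]
  have hlast : ((α (Fin.last m) : ℤ) : ℝ)
      = n - (m * A + N * (m * (m - 1) / 2) + ∑ i, (k i : ℝ)) := by
    rw [hα, completeTuple_last, Int.cast_sub, hsum]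
    simp
  have hk0 : 0 ≤ ∑ i, (k i : ℝ) := Finset.sum_nonneg fun i _ => by positivity
  have hk1 : ∑ i, (k i : ℝ) ≤ m * (N - 1) := by
    have : ∀ i ∈ (Finset.univ : Finset (Fin m)), (k i : ℝ) ≤ N - 1 := by
      intro i _
      have : ((k i + 1 : ℕ) : ℝ) ≤ N := by exact_mod_cast hk i
      push_cast at this
      linarith
    simpa using Finset.sum_le_card_nsmul _ _ _ this
  have hm0 : (0 : ℝ) ≤ m := by positivity
  have hlast_le : α (Fin.last m) ≤ A := by
    have : ((α (Fin.last m) : ℤ) : ℝ) ≤ A := by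
      rw [hlast]
      nlinarith
    exact_mod_cast this
  have hlast_ge : (n : ℝ) / (m + 1) - 3 * m * N / 2 ≤ α (Fin.last m) := by
    have h1 : q - m * N ≤ α (Fin.last m) := by
      rw [hlast]
      nlinarith
    have h2 : N * (m * (m - 1)) / (2 * (m + 1)) ≤ (m : ℝ) * N / 2 := by
      rw [div_le_div_iff₀ (by positivity) (by positivity)]
      nlinarith [mul_nonneg hm0 (Nat.cast_nonneg (α := ℝ) N)]
    rw [hq] at h1
    linarith
  have hanti : Antitone α := by
    have hN' : (1 : ℤ) ≤ N := by exact_mod_cast hN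
    intro i j hij
    induction j using Fin.lastCases with
    | last =>
      induction i using Fin.lastCases with
      | last => exact le_rfl
      | cast i =>
        refine hlast_le.trans ?_
        rw [hα, completeTuple_castSucc, ha]
        have : (0 : ℤ) ≤ (m - 1 - (i : ℕ)) * N := mul_nonneg (by have := i.2; omega) (by omega)
        simp only
        omega
    | cast j =>
      induction i using Fin.lastCases with
      | last => exact absurd hij (not_le.mpr (Fin.castSucc_lt_last j))
      | cast i =>
        rcases eq_or_lt_of_le hij with h | h
        · rw [h]
        rw [hα, completeTuple_castSucc, completeTuple_castSucc, ha]
        have hij' : ((i : ℕ) : ℤ) + 1 ≤ (j : ℕ) := by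
          exact_mod_cast (Fin.castSucc_lt_castSucc_iff.mp h)
        have hkj : ((k j : ℕ) : ℤ) < N := by exact_mod_cast hk j
        simp only
        nlinarith [Int.natCast_nonneg (k i)]
  have hge : ∀ i, (n : ℝ) / (m + 1) - 3 * m * N / 2 ≤ α i := fun i =>
    hlast_ge.trans (by exact_mod_cast hanti (Fin.le_last i))
  refine ⟨mem_Ydn_of_antitone hanti (fun i => ?_) (sum_completeTuple m n a k), hge⟩
  exact_mod_cast hx.trans (hge i)

lemma Ydn_nonempty {d n : ℕ} (hd : 1 ≤ d) : (Ydn d n).Nonempty := by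
  have h0 : (0 : Fin d → ℤ) ≤ Pi.single ⟨0, hd⟩ (n : ℤ) :=
    Pi.single_nonneg.mpr (Int.natCast_nonneg n)
  have hi : ∀ i : Fin d, (⟨0, hd⟩ : Fin d) ≤ i := fun i => Fin.mk_le_of_le_val (Nat.zero_le _)
  refine ⟨Pi.single ⟨0, hd⟩ (n : ℤ), mem_Ydn_of_antitone (fun i j hij => ?_) (fun i => ?_) ?_⟩
  · by_cases hj : j = ⟨0, hd⟩
    · have : i = j := le_antisymm hij (hj ▸ hi i)
      rw [this]
    · rw [Pi.single_eq_of_ne hj]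
      exact h0 i
  · exact h0 i
  · simp

/-- Achievability bound of Lemma 2: there is a unit vector with nonnegative entries whose
quadratic form with `M_est(n,d,D)` is at least
`1 - π²(d-1)²/(d²N²) - (D-d)/(n/d - 3(d-1)N/2 + D - d)`. -/
theorem stmt5 (d D n N : ℕ) (hd : 2 ≤ d) (hdD : d ≤ D) (hn : 1 ≤ n) (hN : 2 ≤ N)
    (h1 : 3 * ((d : ℝ) - 1) * (N : ℝ) / 2 ≤ (n : ℝ) / (d : ℝ) + (d : ℝ) - 2)
    (h2 : 0 < (n : ℝ) / (d : ℝ) - 3 * ((d : ℝ) - 1) * (N : ℝ) / 2 + (D : ℝ) - (d : ℝ)) :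
    ∃ v : (Fin d → ℤ) → ℝ, (∀ α, 0 ≤ v α) ∧ (∑ α ∈ Ydn d n, (v α) ^ 2) = 1 ∧
      ∑ α ∈ Ydn d n, ∑ β ∈ Ydn d n, v α * Mest n d D α β * v β
        ≥ 1 - Real.pi ^ 2 * ((d : ℝ) - 1) ^ 2 / ((d : ℝ) ^ 2 * (N : ℝ) ^ 2)
            - ((D : ℝ) - (d : ℝ))
              / ((n : ℝ) / (d : ℝ) - 3 * ((d : ℝ) - 1) * (N : ℝ) / 2 + (D : ℝ) - (d : ℝ)) := by
  obtain ⟨m, rfl⟩ : ∃ m, d = m + 1 := ⟨d - 1, by omega⟩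
  have hm : 1 ≤ m := by omega
  have hD : ((m + 1 : ℕ) : ℝ) ≤ D := by exact_mod_cast hdD
  set x : ℝ := (n : ℝ) / (m + 1) - 3 * m * N / 2 with hx
  have hden : (n : ℝ) / ((m + 1 : ℕ) : ℝ) - 3 * (((m + 1 : ℕ) : ℝ) - 1) * (N : ℝ) / 2 + (D : ℝ)
      - ((m + 1 : ℕ) : ℝ) = x + (D - ((m + 1 : ℕ) : ℝ)) := by
    rw [hx]; push_cast; ring
  rw [hden] at h2 ⊢
  set δ := Real.pi ^ 2 * (((m + 1 : ℕ) : ℝ) - 1) ^ 2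
    / (((m + 1 : ℕ) : ℝ) ^ 2 * (N : ℝ) ^ 2) with hδ'
  have hδ : 0 ≤ δ := by positivity
  have hr : 1 - (D - ((m + 1 : ℕ) : ℝ)) / (x + (D - ((m + 1 : ℕ) : ℝ)))
      = x / (x + (D - ((m + 1 : ℕ) : ℝ))) := by
    rw [eq_div_iff h2.ne', sub_mul, div_mul_cancel₀ _ h2.ne']; ring
  rcases lt_or_ge x 0 with hx0 | hx0
  · obtain ⟨α₀, hα₀⟩ := Ydn_nonempty (d := m + 1) (n := n) (by omega)
    have hv : (0 : (Fin (m + 1) → ℤ) → ℝ) ≤ Pi.single α₀ 1 := Pi.single_nonneg.mpr zero_le_one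
    refine ⟨Pi.single α₀ 1, hv, ?_, ?_⟩
    · simp [Pi.single_apply, hα₀]
    · have hneg := div_neg_of_neg_of_pos hx0 h2
      have : 0 ≤ ∑ α ∈ Ydn (m + 1) n, ∑ β ∈ Ydn (m + 1) n,
          (Pi.single α₀ 1 : (Fin (m + 1) → ℤ) → ℝ) α * Mest n (m + 1) D α β
            * (Pi.single α₀ 1 : (Fin (m + 1) → ℤ) → ℝ) β :=
        Finset.sum_nonneg fun α _ => Finset.sum_nonneg fun β _ =>
          mul_nonneg (mul_nonneg (hv α) (Mest_nonneg n (m + 1) D α β)) (hv β)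
      linarith
  · obtain ⟨a, ha⟩ := exists_windows m n N (by omega) hx0
    obtain ⟨g, g_nonneg, g_supp, g_zero, g_add, g_sub⟩ := exists_sine_profile N hN
    set c := Real.cos (Real.pi / N) with hc
    have hshift := sum_productState_mul_shift g_supp (fun k hk => (ha k hk).1)
    have hform := quadraticForm_Mest_ge hdD hx0 h2
      (productState_nonneg (m := m) (n := n) (a := a) g_nonneg)
      (fun α hα => by
        obtain ⟨k, hk, rfl⟩ := exists_completeTuple_of_productState_ne_zero g_supp hα
        exact (ha k hk).1)
      (fun α hα => by
        obtain ⟨k, hk, rfl⟩ := exists_completeTuple_of_productState_ne_zero g_supp hα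
        exact (ha k hk).2)
    refine ⟨productState m n a g, productState_nonneg g_nonneg, ?_, hform.trans' ?_⟩
    · have h := hshift 0 0
      simp only [add_sub_cancel_right, sub_self, add_zero, g_zero, Finset.prod_const_one] at h
      simpa only [sq] using h
    · have hcorr := sum_prod_shift_ge m hm (fun s => ∑ k ∈ Finset.range N, g k * g (k + s)) c
        (by simpa using g_zero) g_add (by simpa only [← sub_eq_add_neg] using g_sub)
      have hcos : 1 - (Real.pi / N) ^ 2 / 2 ≤ c := Real.one_sub_sq_div_two_le_cos
      have hN0 : (0 : ℝ) < N := by positivity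
      have hδeq : 1 - δ = 1 / ((m + 1 : ℕ) : ℝ) ^ 2
          * (((m : ℝ) + 1) ^ 2 - 2 * (m : ℝ) ^ 2 * ((Real.pi / N) ^ 2 / 2)) := by
        rw [hδ']; push_cast; field_simp; ring
      have havg : 1 - δ ≤ 1 / ((m + 1 : ℕ) : ℝ) ^ 2 * ∑ i : Fin (m + 1), ∑ j : Fin (m + 1),
          ∑ α ∈ Ydn (m + 1) n, productState m n a g α
            * productState m n a g (α + ebasis (m + 1) i - ebasis (m + 1) j) := by
        rw [hδeq]
        simp only [hshift]
        refine mul_le_mul_of_nonneg_left (hcorr.trans' ?_) (by positivity)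
        nlinarith [sq_nonneg (m : ℝ)]
      have hr0 : 0 ≤ x / (x + (D - ((m + 1 : ℕ) : ℝ))) := by positivity
      have hε : 0 ≤ (D - ((m + 1 : ℕ) : ℝ)) / (x + (D - ((m + 1 : ℕ) : ℝ))) :=
        div_nonneg (by linarith) h2.le
      refine (mul_le_mul_of_nonneg_left havg hr0).trans' ?_
      rw [← hr]
      nlinarith [mul_nonneg hε hδ]
end
end

section
/- Under the S_Young construction with d ≥ 2, D ≥ d and 3(d−1)N/2 ≤ n/d + d − 2, the estimation matrix is sparse on S_Young: for all ᾱ, β̄ ∈ {0,…,N−1}^{d−1}, if (M_est(n,d,D))_{α(ᾱ) α(β̄)} ≠ 0 then the difference ᾱ − β̄ belongs to {0} ∪ {±ẽ_i : 1 ≤ i ≤ d−1} ∪ {ẽ_i − ẽ_j : 1 ≤ i ≠ j ≤ d−1}, where ẽ_i denotes the i-th standard basis vector of ℤ^{d−1}. -/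
open scoped Classical

noncomputable section

/-- `A_i = q + (d - i) N + [i ≤ r]` for the 1-based index `i`; here the argument `i`
is 0-based, so the 1-based index is `i + 1`. -/
def Ai (d N : ℕ) (q r : ℤ) (i : ℕ) : ℤ :=
  q + ((d : ℤ) - ((i : ℤ) + 1)) * (N : ℤ) + (if (i : ℤ) + 1 ≤ r then 1 else 0)

/-- The map `ᾱ ↦ α(ᾱ)` of the `S_Young` construction. -/
def alphaMap (d n N : ℕ) (q r : ℤ) (bar : Fin (d - 1) → ℤ) : Fin d → ℤ :=
  fun i => if h : (i : ℕ) < d - 1 then Ai d N q r i + bar ⟨i, h⟩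
           else (n : ℤ) - ∑ j : Fin (d - 1), (Ai d N q r j + bar j)

/-- The index set `{0, 1, …, N-1}^{d-1}`. -/
def barSet (d N : ℕ) : Finset (Fin (d - 1) → ℤ) :=
  Fintype.piFinset fun _ => Finset.Icc (0 : ℤ) ((N : ℤ) - 1)

theorem exists_add_ebasis_eq_of_Mest_ne_zero {n d D : ℕ} {α β : Fin d → ℤ}
    (h : Mest n d D α β ≠ 0) : ∃ i j : Fin d, α + ebasis d i = β + ebasis d j := by
  by_contra! hne
  exact h (by simp [Mest, hne])

/-- Two tuples in the `S_Young` construction differ, in each of the first `d - 1` coordinates,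
exactly by the difference of their indices. -/
theorem alphaMap_sub_alphaMap_castLE {d n N : ℕ} {q r : ℤ} (bar bar' : Fin (d - 1) → ℤ)
    (k : Fin (d - 1)) :
    alphaMap d n N q r bar (k.castLE (Nat.sub_le d 1)) -
      alphaMap d n N q r bar' (k.castLE (Nat.sub_le d 1)) = bar k - bar' k := by
  simp [alphaMap]

theorem ebasis_castLE {d e : ℕ} (h : e ≤ d) {i : Fin d} (hi : (i : ℕ) < e) (k : Fin e) :
    ebasis d i (k.castLE h) = ebasis e ⟨i, hi⟩ k := by
  simp [ebasis, Fin.ext_iff]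

theorem ebasis_castLE_of_le {d e : ℕ} (h : e ≤ d) {i : Fin d} (hi : e ≤ (i : ℕ)) (k : Fin e) :
    ebasis d i (k.castLE h) = 0 := by
  have := k.isLt
  simp only [ebasis, Fin.ext_iff, Fin.val_castLE, ite_eq_right_iff]
  omega

/-- Sparsity of the estimation matrix on `S_Young`: a nonzero entry forces
`ᾱ - β̄ ∈ {0} ∪ {±ẽᵢ} ∪ {ẽᵢ - ẽⱼ, i ≠ j}`. -/
theorem stmt11 (d D n N : ℕ) (hd : 2 ≤ d) (hdD : d ≤ D) (hn : 1 ≤ n) (hN : 1 ≤ N)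
    (h1 : 3 * ((d : ℝ) - 1) * (N : ℝ) / 2 ≤ (n : ℝ) / (d : ℝ) + (d : ℝ) - 2)
    (q r : ℤ) (hq : 0 ≤ q) (hr0 : 0 ≤ r) (hr1 : r ≤ (d : ℤ) - 1)
    (hqr : 2 * (n : ℤ) = (d : ℤ) * ((d : ℤ) - 1) * (N : ℤ) + 2 * ((d : ℤ) * q + r))
    (bar bar' : Fin (d - 1) → ℤ) (hbar : bar ∈ barSet d N) (hbar' : bar' ∈ barSet d N)
    (hM : Mest n d D (alphaMap d n N q r bar) (alphaMap d n N q r bar') ≠ 0) :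
    bar - bar' = 0 ∨
      (∃ i : Fin (d - 1), bar - bar' = ebasis (d - 1) i) ∨
      (∃ i : Fin (d - 1), bar - bar' = -ebasis (d - 1) i) ∨
      (∃ i j : Fin (d - 1), i ≠ j ∧ bar - bar' = ebasis (d - 1) i - ebasis (d - 1) j) := by
  obtain ⟨i, j, hij⟩ := exists_add_ebasis_eq_of_Mest_ne_zero hM
  have hle := Nat.sub_le d 1
  have key (k : Fin (d - 1)) :
      bar k - bar' k = ebasis d j (k.castLE hle) - ebasis d i (k.castLE hle) := by
    have h := congrFun hij (k.castLE hle)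
    have hk := alphaMap_sub_alphaMap_castLE (n := n) (N := N) (q := q) (r := r) bar bar' k
    simp only [Pi.add_apply] at h
    linarith
  by_cases hi : (i : ℕ) < d - 1 <;> by_cases hj : (j : ℕ) < d - 1
  · by_cases h : i = j
    · left
      ext k
      simp [key, h]
    · refine .inr (.inr (.inr ⟨⟨j, hj⟩, ⟨i, hi⟩, ?_, ?_⟩))
      · simpa [Fin.ext_iff, eq_comm] using h
      · ext k
        simp [key, ebasis_castLE hle hi, ebasis_castLE hle hj]
  · refine .inr (.inr (.inl ⟨⟨i, hi⟩, ?_⟩))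
    ext k
    simp [key, ebasis_castLE hle hi, ebasis_castLE_of_le hle (not_lt.mp hj)]
  · refine .inr (.inl ⟨⟨j, hj⟩, ?_⟩)
    ext k
    simp [key, ebasis_castLE hle hj, ebasis_castLE_of_le hle (not_lt.mp hi)]
  · left
    ext k
    simp [key, ebasis_castLE_of_le hle (not_lt.mp hi), ebasis_castLE_of_le hle (not_lt.mp hj)]
end
end
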